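/- Let θ ↦ π_θ be a parametrized policy family whose score function is bounded with constant Π_*, let ε > 0, and suppose ∇J is L-Lipschitz for some L > 0. Let C ≥ 1 and K ≥ 1 be natural numbers, let 0 < η ≤ 1/L, and define iterates by θ_{c,e+1} := θ_{c,e} + η · g_PPO^clip(θ_{c,e}, θ_{c,0}) for e = 0, …, K−1, with θ_{c+1,0} := θ_{c,K}, starting from an arbitrary θ_{0,0} ∈ ℝ^d. Set J_* := sup_θ J(θ) (which is finite since |J| ≤ R_*(1−γ^T)/(1−γ)), Δ_0 := J_* − J(θ_{0,0}), R := Π_*² R_* ( 8Tγ/(1−γ)³ + (2T/(1−γ))(1 + 1/ε) ), and G := 2 Π_* R_* ((1−γ^T)/(1−γ))². Then min over c ∈ {0,…,C−1} and e ∈ {0,…,K−1} of ‖∇J(θ_{c,e})‖² is at most 2Δ_0/(ηCK) + (1/6) η² (K−1)(2K−1) R² G². -/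

import Mathlib

/-- Value with `n` steps remaining. -/
noncomputable def valAux {S A : Type*} [Fintype S] [Fintype A]
    (γ : ℝ) (r : S → A → ℝ) (p : S → A → S → ℝ) (π : S → A → ℝ) : ℕ → S → ℝ
  | 0 => fun _ => 0
  | n + 1 => fun s => ∑ a, π s a * (r s a + γ * ∑ s', p s a s' * valAux γ r p π n s')

/-- Finite-horizon value function `V_t^π` with horizon `T`. -/
noncomputable def Vval {S A : Type*} [Fintype S] [Fintype A]
    (γ : ℝ) (r : S → A → ℝ) (p : S → A → S → ℝ) (π : S → A → ℝ)
    (T t : ℕ) (s : S) : ℝ :=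
  valAux γ r p π (T - t) s

/-- Finite-horizon state-action value `Q_t^π(s,a)`. -/
noncomputable def Qval {S A : Type*} [Fintype S] [Fintype A]
    (γ : ℝ) (r : S → A → ℝ) (p : S → A → S → ℝ) (π : S → A → ℝ)
    (T t : ℕ) (s : S) (a : A) : ℝ :=
  r s a + γ * ∑ s', p s a s' * Vval γ r p π T (t + 1) s'

/-- Advantage `𝔸_t^π(s,a) = Q_t^π(s,a) - V_t^π(s)`. -/
noncomputable def Adv {S A : Type*} [Fintype S] [Fintype A]
    (γ : ℝ) (r : S → A → ℝ) (p : S → A → S → ℝ) (π : S → A → ℝ)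
    (T t : ℕ) (s : S) (a : A) : ℝ :=
  Qval γ r p π T t s a - Vval γ r p π T t s

/-- State marginals `d_t^π`. -/
noncomputable def stateMarginal {S A : Type*} [Fintype S] [Fintype A]
    (p : S → A → S → ℝ) (μ : S → ℝ) (π : S → A → ℝ) : ℕ → S → ℝ
  | 0 => μ
  | t + 1 => fun s => ∑ s', stateMarginal p μ π t s' * ∑ a, π s' a * p s' a s

/-- Clipped PPO surrogate gradient with clipping parameter `ε`. -/
noncomputable def gPPOclip {S A : Type*} [Fintype S] [Fintype A] {d : ℕ}
    (γ : ℝ) (r : S → A → ℝ) (p : S → A → S → ℝ) (μ : S → ℝ) (T : ℕ) (ε : ℝ)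
    (π : EuclideanSpace ℝ (Fin d) → S → A → ℝ)
    (θ θold : EuclideanSpace ℝ (Fin d)) : EuclideanSpace ℝ (Fin d) :=
  ∑ t ∈ Finset.range T, ∑ s, ∑ a,
    (γ ^ t * stateMarginal p μ (π θold) t s *
        (if |π θ s a / π θold s a - 1| ≤ ε then (1 : ℝ) else 0) *
        Adv γ r p (π θold) T t s a) •
      gradient (fun θ' => π θ' s a) θ


/-- Action value with `n` further steps remaining after the current one. -/
noncomputable def qAux {S A : Type*} [Fintype S] [Fintype A]
    (γ : ℝ) (r : S → A → ℝ) (p : S → A → S → ℝ) (π : S → A → ℝ) (n : ℕ) (s : S) (a : A) : ℝ :=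
  r s a + γ * ∑ s', p s a s' * valAux γ r p π n s'

theorem abs_sum_mul_le_of_abs_le {ι : Type*} [Fintype ι] (w f : ι → ℝ) (B : ℝ)
    (hf : ∀ i, |f i| ≤ B) : |∑ i, w i * f i| ≤ (∑ i, |w i|) * B := by
  rw [Finset.sum_mul]
  refine (Finset.abs_sum_le_sum_abs _ _).trans (Finset.sum_le_sum fun i _ => ?_)
  rw [abs_mul]
  exact mul_le_mul_of_nonneg_left (hf i) (abs_nonneg _)

theorem abs_weighted_sum_le {ι : Type*} [Fintype ι] (w f : ι → ℝ) (B : ℝ)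
    (hw0 : ∀ i, 0 ≤ w i) (hw1 : ∑ i, w i = 1) (hf : ∀ i, |f i| ≤ B) :
    |∑ i, w i * f i| ≤ B := by
  have h := abs_sum_mul_le_of_abs_le w f B hf
  simpa only [abs_of_nonneg (hw0 _), hw1, one_mul] using h

theorem mul_pow_mul_one_sub_le {γ : ℝ} (hγ0 : 0 < γ) (hγ1 : γ < 1) (t : ℕ) :
    (t : ℝ) * γ ^ t * (1 - γ) ≤ γ := by
  induction t with
  | zero => simpa using hγ0.le
  | succ t ih =>
    have h1 : γ ^ t ≤ 1 := pow_le_one₀ hγ0.le hγ1.le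
    have h2 : γ * ((t : ℝ) * γ ^ t * (1 - γ)) ≤ γ * γ := mul_le_mul_of_nonneg_left ih hγ0.le
    have h3 : γ ^ t * (γ * (1 - γ)) ≤ 1 * (γ * (1 - γ)) :=
      mul_le_mul_of_nonneg_right h1 (mul_nonneg hγ0.le (sub_nonneg.2 hγ1.le))
    push_cast
    rw [pow_succ]
    linarith

section MDP

variable {S A : Type*} [Fintype S] [Fintype A] {γ : ℝ} {r : S → A → ℝ} {p : S → A → S → ℝ}
  {Rs : ℝ} {π π' : S → A → ℝ}

theorem valAux_succ (n : ℕ) (s : S) :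
    valAux γ r p π (n + 1) s = ∑ a, π s a * qAux γ r p π n s a := rfl

theorem abs_qAux_le_of_abs_valAux_le (hγ0 : 0 < γ) (hr : ∀ s a, |r s a| ≤ Rs)
    (hp0 : ∀ s a s', 0 ≤ p s a s') (hp1 : ∀ s a, ∑ s', p s a s' = 1) {n : ℕ} {B : ℝ}
    (hB : ∀ s, |valAux γ r p π n s| ≤ B) (s : S) (a : A) :
    |qAux γ r p π n s a| ≤ Rs + γ * B := by
  refine (abs_add_le _ _).trans (add_le_add (hr s a) ?_)
  rw [abs_mul, abs_of_pos hγ0]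
  exact mul_le_mul_of_nonneg_left (abs_weighted_sum_le _ _ _ (hp0 s a) (hp1 s a) hB) hγ0.le

theorem add_mul_geom (hγ1 : γ < 1) (n : ℕ) :
    Rs + γ * (Rs * ((1 - γ ^ n) / (1 - γ))) = Rs * ((1 - γ ^ (n + 1)) / (1 - γ)) := by
  have : 1 - γ ≠ 0 := (sub_pos.2 hγ1).ne'
  field_simp
  ring

theorem abs_valAux_le (hγ0 : 0 < γ) (hγ1 : γ < 1) (hr : ∀ s a, |r s a| ≤ Rs)
    (hp0 : ∀ s a s', 0 ≤ p s a s') (hp1 : ∀ s a, ∑ s', p s a s' = 1)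
    (hπ0 : ∀ s a, 0 ≤ π s a) (hπ1 : ∀ s, ∑ a, π s a = 1) (n : ℕ) (s : S) :
    |valAux γ r p π n s| ≤ Rs * ((1 - γ ^ n) / (1 - γ)) := by
  induction n generalizing s with
  | zero => simp [valAux]
  | succ n ih =>
    rw [valAux_succ, ← add_mul_geom hγ1]
    exact abs_weighted_sum_le _ _ _ (hπ0 s) (hπ1 s)
      (abs_qAux_le_of_abs_valAux_le hγ0 hr hp0 hp1 ih s)

theorem abs_qAux_le (hγ0 : 0 < γ) (hγ1 : γ < 1) (hr : ∀ s a, |r s a| ≤ Rs)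
    (hp0 : ∀ s a s', 0 ≤ p s a s') (hp1 : ∀ s a, ∑ s', p s a s' = 1)
    (hπ0 : ∀ s a, 0 ≤ π s a) (hπ1 : ∀ s, ∑ a, π s a = 1) (n : ℕ) (s : S) (a : A) :
    |qAux γ r p π n s a| ≤ Rs * ((1 - γ ^ (n + 1)) / (1 - γ)) := by
  rw [← add_mul_geom hγ1]
  exact abs_qAux_le_of_abs_valAux_le hγ0 hr hp0 hp1
    (abs_valAux_le hγ0 hγ1 hr hp0 hp1 hπ0 hπ1 n) s a

theorem geom_div_le (hγ0 : 0 < γ) (hγ1 : γ < 1) {m n : ℕ} (h : m ≤ n) :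
    (1 - γ ^ m) / (1 - γ) ≤ (1 - γ ^ n) / (1 - γ) :=
  div_le_div_of_nonneg_right (sub_le_sub_left (pow_le_pow_of_le_one hγ0.le hγ1.le h) _)
    (sub_pos.2 hγ1).le

theorem abs_Adv_le (hγ0 : 0 < γ) (hγ1 : γ < 1) (hRs : 0 ≤ Rs) (hr : ∀ s a, |r s a| ≤ Rs)
    (hp0 : ∀ s a s', 0 ≤ p s a s') (hp1 : ∀ s a, ∑ s', p s a s' = 1)
    (hπ0 : ∀ s a, 0 ≤ π s a) (hπ1 : ∀ s, ∑ a, π s a = 1) {T t : ℕ} (ht : t < T)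
    (s : S) (a : A) :
    |Adv γ r p π T t s a| ≤ 2 * Rs * ((1 - γ ^ T) / (1 - γ)) := by
  have hq := (abs_qAux_le hγ0 hγ1 hr hp0 hp1 hπ0 hπ1 (T - (t + 1)) s a).trans
    (mul_le_mul_of_nonneg_left
      (geom_div_le hγ0 hγ1 (show T - (t + 1) + 1 ≤ T by omega)) hRs)
  have hv := (abs_valAux_le hγ0 hγ1 hr hp0 hp1 hπ0 hπ1 (T - t) s).trans
    (mul_le_mul_of_nonneg_left (geom_div_le hγ0 hγ1 (show T - t ≤ T by omega)) hRs)
  have : |Adv γ r p π T t s a| ≤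
      |qAux γ r p π (T - (t + 1)) s a| + |valAux γ r p π (T - t) s| := abs_sub _ _
  linarith

theorem geom_div_le_inv (hγ0 : 0 < γ) (hγ1 : γ < 1) (n : ℕ) :
    (1 - γ ^ n) / (1 - γ) ≤ 1 / (1 - γ) :=
  div_le_div_of_nonneg_right (sub_le_self _ (pow_nonneg hγ0.le n)) (sub_pos.2 hγ1).le

theorem qAux_sub_qAux (n : ℕ) (s : S) (a : A) :
    qAux γ r p π n s a - qAux γ r p π' n s a =
      γ * ∑ s', p s a s' * (valAux γ r p π n s' - valAux γ r p π' n s') := by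
  simp only [qAux, mul_sub, Finset.sum_sub_distrib]
  ring

theorem abs_qAux_sub_le_of_abs_valAux_sub_le (hγ0 : 0 < γ)
    (hp0 : ∀ s a s', 0 ≤ p s a s') (hp1 : ∀ s a, ∑ s', p s a s' = 1) {n : ℕ} {B : ℝ}
    (hB : ∀ s, |valAux γ r p π n s - valAux γ r p π' n s| ≤ B) (s : S) (a : A) :
    |qAux γ r p π n s a - qAux γ r p π' n s a| ≤ γ * B := by
  rw [qAux_sub_qAux, abs_mul, abs_of_pos hγ0]
  exact mul_le_mul_of_nonneg_left (abs_weighted_sum_le _ _ _ (hp0 s a) (hp1 s a) hB) hγ0.le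

theorem abs_valAux_sub_le (hγ0 : 0 < γ) (hγ1 : γ < 1) (hRs : 0 ≤ Rs) (hr : ∀ s a, |r s a| ≤ Rs)
    (hp0 : ∀ s a s', 0 ≤ p s a s') (hp1 : ∀ s a, ∑ s', p s a s' = 1)
    (hπ0 : ∀ s a, 0 ≤ π s a) (hπ1 : ∀ s, ∑ a, π s a = 1)
    (hπ0' : ∀ s a, 0 ≤ π' s a) (hπ1' : ∀ s, ∑ a, π' s a = 1)
    {δ : ℝ} (hδ0 : 0 ≤ δ) (hδ : ∀ s, ∑ a, |π s a - π' s a| ≤ δ) (n : ℕ) (s : S) :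
    |valAux γ r p π n s - valAux γ r p π' n s| ≤ δ * Rs / (1 - γ) ^ 2 := by
  have h1γ : 0 < 1 - γ := sub_pos.2 hγ1
  induction n generalizing s with
  | zero => simp only [valAux, sub_self, abs_zero]; positivity
  | succ n ih =>
    have hsplit : valAux γ r p π (n + 1) s - valAux γ r p π' (n + 1) s =
        ∑ a, (π s a - π' s a) * qAux γ r p π n s a +
          ∑ a, π' s a * (qAux γ r p π n s a - qAux γ r p π' n s a) := by
      rw [valAux_succ, valAux_succ, ← Finset.sum_sub_distrib, ← Finset.sum_add_distrib]
      exact Finset.sum_congr rfl fun a _ => by ring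
    have hq : ∀ a, |qAux γ r p π n s a| ≤ Rs * (1 / (1 - γ)) := fun a =>
      (abs_qAux_le hγ0 hγ1 hr hp0 hp1 hπ0 hπ1 n s a).trans
        (mul_le_mul_of_nonneg_left (geom_div_le_inv hγ0 hγ1 _) hRs)
    have h1 : |∑ a, (π s a - π' s a) * qAux γ r p π n s a| ≤ δ * (Rs * (1 / (1 - γ))) :=
      (abs_sum_mul_le_of_abs_le _ _ _ hq).trans
        (mul_le_mul_of_nonneg_right (hδ s) (by positivity))
    have h2 := abs_weighted_sum_le _ _ _ (hπ0' s) (hπ1' s)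
      (abs_qAux_sub_le_of_abs_valAux_sub_le hγ0 hp0 hp1 ih s)
    rw [hsplit]
    refine (abs_add_le _ _).trans ((add_le_add h1 h2).trans (le_of_eq ?_))
    field_simp
    ring

variable {μ : S → ℝ}

theorem stateMarginal_nonneg (hp0 : ∀ s a s', 0 ≤ p s a s') (hμ0 : ∀ s, 0 ≤ μ s)
    (hπ0 : ∀ s a, 0 ≤ π s a) (t : ℕ) (s : S) : 0 ≤ stateMarginal p μ π t s := by
  induction t generalizing s with
  | zero => exact hμ0 s
  | succ t ih =>
    exact Finset.sum_nonneg fun s' _ => mul_nonneg (ih s')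
      (Finset.sum_nonneg fun a _ => mul_nonneg (hπ0 s' a) (hp0 s' a s))

theorem sum_sum_mul_transition (hp1 : ∀ s a, ∑ s', p s a s' = 1) (w : S → ℝ) (f : S → A → ℝ) :
    ∑ s, ∑ s', w s' * ∑ a, f s' a * p s' a s = ∑ s', w s' * ∑ a, f s' a := by
  rw [Finset.sum_comm]
  refine Finset.sum_congr rfl fun s' _ => ?_
  rw [← Finset.mul_sum, Finset.sum_comm]
  simp only [← Finset.mul_sum, hp1, mul_one]

theorem sum_stateMarginal (hp1 : ∀ s a, ∑ s', p s a s' = 1) (hμ1 : ∑ s, μ s = 1)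
    (hπ1 : ∀ s, ∑ a, π s a = 1) (t : ℕ) : ∑ s, stateMarginal p μ π t s = 1 := by
  induction t with
  | zero => exact hμ1
  | succ t ih =>
    simp only [stateMarginal]
    rw [sum_sum_mul_transition hp1]
    simpa only [hπ1, mul_one] using ih

theorem sum_abs_stateMarginal_sub_le (hp0 : ∀ s a s', 0 ≤ p s a s')
    (hp1 : ∀ s a, ∑ s', p s a s' = 1) (hμ0 : ∀ s, 0 ≤ μ s) (hμ1 : ∑ s, μ s = 1)
    (hπ0 : ∀ s a, 0 ≤ π s a) (hπ1 : ∀ s, ∑ a, π s a = 1)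
    (hπ0' : ∀ s a, 0 ≤ π' s a) (hπ1' : ∀ s, ∑ a, π' s a = 1)
    {δ : ℝ} (hδ : ∀ s, ∑ a, |π s a - π' s a| ≤ δ) (t : ℕ) :
    ∑ s, |stateMarginal p μ π t s - stateMarginal p μ π' t s| ≤ t * δ := by
  induction t with
  | zero => simp [stateMarginal]
  | succ t ih =>
    set d := stateMarginal p μ π t
    set d' := stateMarginal p μ π' t
    have hd' : ∀ s, 0 ≤ d' s := stateMarginal_nonneg hp0 hμ0 hπ0' t
    have hpt : ∀ s, |stateMarginal p μ π (t + 1) s - stateMarginal p μ π' (t + 1) s| ≤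
        ∑ s', |d s' - d' s'| * ∑ a, π s' a * p s' a s +
          ∑ s', d' s' * ∑ a, |π s' a - π' s' a| * p s' a s := by
      intro s
      have hsplit : stateMarginal p μ π (t + 1) s - stateMarginal p μ π' (t + 1) s =
          ∑ s', (d s' - d' s') * ∑ a, π s' a * p s' a s +
            ∑ s', d' s' * ∑ a, (π s' a - π' s' a) * p s' a s := by
        simp only [stateMarginal, sub_mul, mul_sub, Finset.sum_sub_distrib]
        ring
      rw [hsplit]
      refine (abs_add_le _ _).trans (add_le_add ?_ ?_) <;>
        refine (Finset.abs_sum_le_sum_abs _ _).trans (Finset.sum_le_sum fun s' _ => ?_)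
      · rw [abs_mul, abs_of_nonneg (Finset.sum_nonneg fun a _ =>
          mul_nonneg (hπ0 s' a) (hp0 s' a s))]
      · rw [abs_mul, abs_of_nonneg (hd' s')]
        refine mul_le_mul_of_nonneg_left ?_ (hd' s')
        refine (Finset.abs_sum_le_sum_abs _ _).trans (Finset.sum_le_sum fun a _ => ?_)
        rw [abs_mul, abs_of_nonneg (hp0 s' a s)]
    refine (Finset.sum_le_sum fun s _ => hpt s).trans ?_
    rw [Finset.sum_add_distrib, sum_sum_mul_transition hp1, sum_sum_mul_transition hp1]
    have h2 : ∑ s', d' s' * ∑ a, |π s' a - π' s' a| ≤ ∑ s', d' s' * δ :=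
      Finset.sum_le_sum fun s' _ => mul_le_mul_of_nonneg_left (hδ s') (hd' s')
    rw [← Finset.sum_mul, sum_stateMarginal hp1 hμ1 hπ1', one_mul] at h2
    simp only [hπ1, mul_one]
    push_cast
    linarith

/-- The `u`-mass of the set where the ratio `u / v` leaves `[1 - ε, 1 + ε]` is controlled by the
`ℓ¹` distance of `u` and `v`. -/
theorem sum_mul_not_clip_le {ε : ℝ} (hε : 0 < ε) {u v : A → ℝ} (hv : ∀ a, 0 < v a) :
    ∑ a, u a * (1 - if |u a / v a - 1| ≤ ε then (1 : ℝ) else 0) ≤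
      (1 + 1 / ε) * ∑ a, |u a - v a| := by
  rw [Finset.mul_sum]
  refine Finset.sum_le_sum fun a _ => ?_
  split_ifs with h
  · rw [sub_self, mul_zero]; positivity
  · push Not at h
    have h1 : u a / v a - 1 = (u a - v a) / v a := by
      have := (hv a).ne'
      field_simp
    rw [h1, abs_div, abs_of_pos (hv a), lt_div_iff₀ (hv a)] at h
    have h2 : v a ≤ 1 / ε * |u a - v a| := by
      rw [one_div, inv_mul_eq_div, le_div_iff₀ hε]; linarith
    have := le_abs_self (u a - v a)
    linarith

/-- Norm bound for a weighted sum of policy gradients with bounded score. -/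
theorem norm_sum_smul_score_le {E : Type*} [NormedAddCommGroup E] [NormedSpace ℝ E] {Pis B : ℝ} {v : S → A → E}
    (hv : ∀ s a, ‖v s a‖ ≤ Pis * π s a) (w : S → ℝ) (x : S → A → ℝ)
    (hx : ∀ s, ∑ a, |x s a| * π s a ≤ B) (hPis : 0 ≤ Pis) :
    ‖∑ s, ∑ a, (w s * x s a) • v s a‖ ≤ (∑ s, |w s|) * (Pis * B) := by
  rw [Finset.sum_mul]
  refine (norm_sum_le _ _).trans (Finset.sum_le_sum fun s _ => ?_)
  have h : ∀ a, ‖(w s * x s a) • v s a‖ ≤ |w s| * (Pis * (|x s a| * π s a)) := fun a => by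
    rw [norm_smul, Real.norm_eq_abs, abs_mul, mul_assoc]
    refine mul_le_mul_of_nonneg_left ?_ (abs_nonneg _)
    calc |x s a| * ‖v s a‖ ≤ |x s a| * (Pis * π s a) :=
          mul_le_mul_of_nonneg_left (hv s a) (abs_nonneg _)
      _ = _ := by ring
  refine (norm_sum_le _ _).trans ((Finset.sum_le_sum fun a _ => h a).trans ?_)
  rw [← Finset.mul_sum, ← Finset.mul_sum]
  exact mul_le_mul_of_nonneg_left (mul_le_mul_of_nonneg_left (hx s) hPis) (abs_nonneg _)

theorem sum_abs_mul_le {B : ℝ} {u x : A → ℝ} (hu0 : ∀ a, 0 ≤ u a) (hu1 : ∑ a, u a = 1)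
    (hx : ∀ a, |x a| ≤ B) : ∑ a, |x a| * u a ≤ B := by
  calc ∑ a, |x a| * u a ≤ ∑ a, B * u a :=
        Finset.sum_le_sum fun a _ => mul_le_mul_of_nonneg_right (hx a) (hu0 a)
    _ = B := by rw [← Finset.mul_sum, hu1, mul_one]

end MDP

section PolicyGradientRecursion

variable {E : Type*} [NormedAddCommGroup E] [InnerProductSpace ℝ E]
  {S A : Type*} [Fintype S] [Fintype A] {γ : ℝ} {r : S → A → ℝ} {p : S → A → S → ℝ}

/-- Gradient of the value with `n` steps remaining, computed by backward recursion from the policy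
gradients `v`. -/
noncomputable def gradValAux (γ : ℝ) (r : S → A → ℝ) (p : S → A → S → ℝ) (π : S → A → ℝ)
    (v : S → A → E) : ℕ → S → E
  | 0 => fun _ => 0
  | n + 1 => fun s => ∑ a, (π s a • γ • ∑ s', p s a s' • gradValAux γ r p π v n s' +
      qAux γ r p π n s a • v s a)

/-- Contribution of time `t` to the policy gradient. -/
noncomputable def policyGradientTerm (γ : ℝ) (r : S → A → ℝ) (p : S → A → S → ℝ) (μ : S → ℝ)
    (π : S → A → ℝ) (v : S → A → E) (T t : ℕ) : E :=
  γ ^ t • ∑ s, ∑ a, (stateMarginal p μ π t s * qAux γ r p π (T - (t + 1)) s a) • v s a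

theorem sum_smul_gradValAux (μ : S → ℝ) (π : S → A → ℝ) (v : S → A → E) (T k : ℕ) (hk : k ≤ T) :
    ∑ s, μ s • gradValAux γ r p π v T s =
      ∑ t ∈ Finset.range k, policyGradientTerm γ r p μ π v T t +
        γ ^ k • ∑ s, stateMarginal p μ π k s • gradValAux γ r p π v (T - k) s := by
  induction k with
  | zero => simp [stateMarginal]
  | succ k ih =>
    rw [ih (by omega), Finset.sum_range_succ, add_assoc]
    congr 1
    obtain ⟨m, hm⟩ : ∃ m, T - k = m + 1 := ⟨T - k - 1, by omega⟩
    have hm' : T - (k + 1) = m := by omega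
    rw [policyGradientTerm, hm, hm', pow_succ, mul_smul, ← smul_add]
    congr 1
    simp only [gradValAux, stateMarginal, Finset.smul_sum, Finset.sum_add_distrib, smul_add,
      smul_smul, Finset.sum_smul, Finset.mul_sum]
    rw [add_comm]
    congr 1
    calc _ = ∑ s, ∑ s', ∑ a, _ := Finset.sum_congr rfl fun s _ => Finset.sum_comm
      _ = ∑ s', ∑ s, ∑ a, _ := Finset.sum_comm
      _ = _ := Finset.sum_congr rfl fun s' _ => Finset.sum_congr rfl fun s _ =>
        Finset.sum_congr rfl fun a _ => by congr 1; ring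

theorem sum_smul_gradValAux_eq (μ : S → ℝ) (π : S → A → ℝ) (v : S → A → E) (T : ℕ) :
    ∑ s, μ s • gradValAux γ r p π v T s =
      ∑ t ∈ Finset.range T, policyGradientTerm γ r p μ π v T t := by
  simp [sum_smul_gradValAux μ π v T T le_rfl, gradValAux]

end PolicyGradientRecursion

section Smooth

variable {E : Type*} [NormedAddCommGroup E] [InnerProductSpace ℝ E] [CompleteSpace E]

/-- Quadratic lower bound for a function with Lipschitz gradient. -/
theorem add_inner_gradient_sub_le {J : E → ℝ} (hJ : Differentiable ℝ J) {L : ℝ}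
    (hLip : ∀ x y, ‖gradient J x - gradient J y‖ ≤ L * ‖x - y‖) (x h : E) :
    J x + inner ℝ (gradient J x) h - L / 2 * ‖h‖ ^ 2 ≤ J (x + h) := by
  set φ : ℝ → ℝ := fun t => J (x + t • h) - t * inner ℝ (gradient J x) h + L / 2 * ‖h‖ ^ 2 * t ^ 2
  have hφ : ∀ t, HasDerivAt φ
      (inner ℝ (gradient J (x + t • h)) h - inner ℝ (gradient J x) h + L * ‖h‖ ^ 2 * t) t := by
    intro t
    have h1 : HasDerivAt (fun t : ℝ => x + t • h) h t := by
      simpa using ((hasDerivAt_id t).smul_const h).const_add x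
    have h2 : HasDerivAt (fun t : ℝ => J (x + t • h)) (inner ℝ (gradient J (x + t • h)) h) t := by
      rw [inner_gradient_left]
      exact (hJ (x + t • h)).hasFDerivAt.comp_hasDerivAt t h1
    have h3 : HasDerivAt (fun t : ℝ => t * inner ℝ (gradient J x) h)
        (inner ℝ (gradient J x) h) t := by
      simpa using (hasDerivAt_id t).mul_const (inner ℝ (gradient J x) h)
    have h4 : HasDerivAt (fun t : ℝ => L / 2 * ‖h‖ ^ 2 * t ^ 2) (L * ‖h‖ ^ 2 * t) t := by
      refine ((hasDerivAt_pow 2 t).const_mul (L / 2 * ‖h‖ ^ 2)).congr_deriv ?_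
      norm_num
      ring
    exact (h2.sub h3).add h4
  have hmono : MonotoneOn φ (Set.Icc 0 1) := by
    refine monotoneOn_of_deriv_nonneg (convex_Icc 0 1)
      (fun t _ => (hφ t).continuousAt.continuousWithinAt)
      (fun t _ => (hφ t).differentiableAt.differentiableWithinAt) fun t ht => ?_
    rw [interior_Icc] at ht
    rw [(hφ t).deriv, ← inner_sub_left]
    have h1 := abs_real_inner_le_norm (gradient J (x + t • h) - gradient J x) h
    have h2 := hLip (x + t • h) x
    rw [add_sub_cancel_left, norm_smul, Real.norm_eq_abs, abs_of_pos ht.1] at h2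
    have h3 := mul_le_mul_of_nonneg_right h2 (norm_nonneg h)
    have h4 := neg_abs_le (inner ℝ (gradient J (x + t • h) - gradient J x) h)
    nlinarith
  have := hmono (Set.left_mem_Icc.2 zero_le_one) (Set.right_mem_Icc.2 zero_le_one) zero_le_one
  simp only [φ, zero_smul, one_smul, add_zero] at this
  linarith

/-- One step of gradient ascent along an inexact gradient `g`. -/
theorem inexact_ascent_step {J : E → ℝ} (hJ : Differentiable ℝ J) {L : ℝ} (hL : 0 < L)
    (hLip : ∀ x y, ‖gradient J x - gradient J y‖ ≤ L * ‖x - y‖) {η : ℝ} (hη0 : 0 < η)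
    (hη : η ≤ 1 / L) (x g : E) :
    η / 2 * ‖gradient J x‖ ^ 2 ≤
      J (x + η • g) - J x + η / 2 * ‖gradient J x - g‖ ^ 2 := by
  have h1 := add_inner_gradient_sub_le hJ hLip x (η • g)
  rw [inner_smul_right, norm_smul, Real.norm_eq_abs, abs_of_pos hη0] at h1
  have h2 := norm_sub_sq_real (gradient J x) g
  have h3 : η * L ≤ 1 := by rwa [le_div_iff₀ hL] at hη
  have h4 : (η * L) * (η * ‖g‖ ^ 2) ≤ 1 * (η * ‖g‖ ^ 2) :=
    mul_le_mul_of_nonneg_right h3 (by positivity)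
  rw [h2]
  nlinarith

theorem HasGradientAt.fun_mul_real {f g : E → ℝ} {f' g' x : E} (hf : HasGradientAt f f' x)
    (hg : HasGradientAt g g' x) :
    HasGradientAt (fun y => f y * g y) (f x • g' + g x • f') x := by
  rw [hasGradientAt_iff_hasFDerivAt] at *
  simpa using hf.fun_mul hg

theorem HasGradientAt.const_mul_real {f : E → ℝ} {f' x : E} (c : ℝ) (hf : HasGradientAt f f' x) :
    HasGradientAt (fun y => c * f y) (c • f') x := by
  rw [hasGradientAt_iff_hasFDerivAt] at *
  simpa using hf.const_mul c

theorem HasGradientAt.const_add_real {f : E → ℝ} {f' x : E} (c : ℝ) (hf : HasGradientAt f f' x) :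
    HasGradientAt (fun y => c + f y) f' x := by
  rw [hasGradientAt_iff_hasFDerivAt] at *
  simpa using hf.const_add c

theorem HasGradientAt.fun_sum_real {ι : Type*} (u : Finset ι) {f : ι → E → ℝ} {f' : ι → E} {x : E}
    (hf : ∀ i ∈ u, HasGradientAt (f i) (f' i) x) :
    HasGradientAt (fun y => ∑ i ∈ u, f i y) (∑ i ∈ u, f' i) x := by
  simp only [hasGradientAt_iff_hasFDerivAt] at *
  simpa using HasFDerivAt.fun_sum hf

variable {S A : Type*} [Fintype S] [Fintype A]
  {γ : ℝ} {r : S → A → ℝ} {p : S → A → S → ℝ}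

theorem hasGradientAt_valAux {π : E → S → A → ℝ} {v : S → A → E} {θ : E}
    (hπ : ∀ s a, HasGradientAt (fun θ => π θ s a) (v s a) θ) (n : ℕ) (s : S) :
    HasGradientAt (fun θ => valAux γ r p (π θ) n s) (gradValAux γ r p (π θ) v n s) θ := by
  induction n generalizing s with
  | zero => exact hasGradientAt_const _ _
  | succ n ih =>
    exact .fun_sum_real _ fun a _ => (hπ s a).fun_mul_real
      (.const_add_real _ (.const_mul_real _ (.fun_sum_real _ fun s' _ => (ih s').const_mul_real _)))

/-- A policy with bounded score is Lipschitz in total variation. -/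
theorem sum_abs_policy_sub_le {Pis : ℝ} {f : E → A → ℝ}
    (hf1 : ∀ θ, ∑ a, f θ a = 1) (hf : ∀ a, Differentiable ℝ fun θ => f θ a)
    (hscore : ∀ θ a, ‖gradient (fun θ' => f θ' a) θ‖ ≤ Pis * f θ a) (θ θ' : E) :
    ∑ a, |f θ a - f θ' a| ≤ Pis * ‖θ - θ'‖ := by
  set σ : A → ℝ := fun a => SignType.sign (f θ a - f θ' a)
  have hσ : ∀ a, |σ a| ≤ 1 := fun a => by
    simp only [σ]
    rcases SignType.sign (f θ a - f θ' a) <;> simp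
  have hgrad : ∀ x, HasGradientAt (fun y => ∑ a, σ a * f y a)
      (∑ a, σ a • gradient (fun y => f y a) x) x := fun x =>
    .fun_sum_real _ fun a _ => .const_mul_real _ (hf a x).hasGradientAt
  have hbound : ∀ x,
      ‖InnerProductSpace.toDual ℝ E (∑ a, σ a • gradient (fun y => f y a) x)‖ ≤ Pis := by
    intro x
    rw [LinearIsometryEquiv.norm_map]
    calc ‖∑ a, σ a • gradient (fun y => f y a) x‖ ≤ ∑ a, Pis * f x a := by
          refine (norm_sum_le _ _).trans (Finset.sum_le_sum fun a _ => ?_)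
          rw [norm_smul, Real.norm_eq_abs]
          exact (mul_le_of_le_one_left (norm_nonneg _) (hσ a)).trans (hscore x a)
      _ = Pis := by rw [← Finset.mul_sum, hf1, mul_one]
  have h := convex_univ.norm_image_sub_le_of_norm_hasFDerivWithin_le
    (fun x _ => (hgrad x).hasFDerivAt.hasFDerivWithinAt) (fun x _ => hbound x)
    (Set.mem_univ θ') (Set.mem_univ θ)
  refine le_trans (le_of_eq ?_) ((le_abs_self _).trans h)
  rw [← Finset.sum_sub_distrib]
  refine Finset.sum_congr rfl fun a _ => ?_
  rw [← mul_sub]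
  exact (sign_mul_self _).symm

theorem hasGradientAt_objective {π : E → S → A → ℝ} {v : S → A → E} {θ : E}
    (hπ : ∀ s a, HasGradientAt (fun θ => π θ s a) (v s a) θ) (μ : S → ℝ) (T : ℕ) :
    HasGradientAt (fun θ => ∑ s, μ s * Vval γ r p (π θ) T 0 s)
      (∑ t ∈ Finset.range T, policyGradientTerm γ r p μ (π θ) v T t) θ := by
  rw [← sum_smul_gradValAux_eq]
  exact .fun_sum_real _ fun s _ => .const_mul_real _ (hasGradientAt_valAux hπ T s)

end Smooth

section Bias

variable {E : Type*} [NormedAddCommGroup E] [InnerProductSpace ℝ E]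
  {S A : Type*} [Fintype S] [Fintype A]
  {γ : ℝ} {r : S → A → ℝ} {p : S → A → S → ℝ} {Rs : ℝ} {μ : S → ℝ}

/-- Contribution of time `t` to the clipped surrogate gradient at the policy `π` with old policy
`π'`, where `v` stands for the policy gradients. -/
noncomputable def clippedTerm (γ : ℝ) (r : S → A → ℝ) (p : S → A → S → ℝ) (μ : S → ℝ) (ε : ℝ)
    (π π' : S → A → ℝ) (v : S → A → E) (T t : ℕ) : E :=
  ∑ s, ∑ a, (γ ^ t * stateMarginal p μ π' t s *
    (if |π s a / π' s a - 1| ≤ ε then (1 : ℝ) else 0) * Adv γ r p π' T t s a) • v s a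

theorem policyGradientTerm_sub_clippedTerm (ε : ℝ) (π π' : S → A → ℝ) {v : S → A → E}
    (hv : ∀ s, ∑ a, v s a = 0) (T t : ℕ) :
    policyGradientTerm γ r p μ π v T t - clippedTerm γ r p μ ε π π' v T t =
      γ ^ t • (∑ s, ∑ a, ((stateMarginal p μ π t s - stateMarginal p μ π' t s) *
            qAux γ r p π (T - (t + 1)) s a) • v s a +
        ∑ s, ∑ a, (stateMarginal p μ π' t s *
          (qAux γ r p π (T - (t + 1)) s a - qAux γ r p π' (T - (t + 1)) s a)) • v s a +
        ∑ s, ∑ a, (stateMarginal p μ π' t s * (Adv γ r p π' T t s a *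
          (1 - if |π s a / π' s a - 1| ≤ ε then (1 : ℝ) else 0))) • v s a) := by
  have hzero : ∑ s, ∑ a, (γ ^ t * stateMarginal p μ π' t s * Vval γ r p π' T t s) • v s a = 0 := by
    simp only [← Finset.smul_sum, hv, smul_zero, Finset.sum_const_zero]
  rw [← add_zero (γ ^ t • _), ← hzero]
  simp only [policyGradientTerm, clippedTerm, Finset.smul_sum, smul_smul,
    ← Finset.sum_add_distrib, ← Finset.sum_sub_distrib, ← add_smul, ← sub_smul]
  refine Finset.sum_congr rfl fun s _ => Finset.sum_congr rfl fun a _ => ?_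
  have hAdv : Adv γ r p π' T t s a = qAux γ r p π' (T - (t + 1)) s a - Vval γ r p π' T t s := rfl
  rw [hAdv]
  congr 1
  ring

theorem norm_policyGradientTerm_sub_clippedTerm_le (hγ0 : 0 < γ) (hγ1 : γ < 1) (hRs : 0 ≤ Rs)
    (hr : ∀ s a, |r s a| ≤ Rs)
    (hp0 : ∀ s a s', 0 ≤ p s a s') (hp1 : ∀ s a, ∑ s', p s a s' = 1)
    (hμ0 : ∀ s, 0 ≤ μ s) (hμ1 : ∑ s, μ s = 1) {π π' : S → A → ℝ}
    (hπ0 : ∀ s a, 0 < π s a) (hπ1 : ∀ s, ∑ a, π s a = 1)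
    (hπ0' : ∀ s a, 0 < π' s a) (hπ1' : ∀ s, ∑ a, π' s a = 1)
    {δ : ℝ} (hδ0 : 0 ≤ δ) (hδ : ∀ s, ∑ a, |π s a - π' s a| ≤ δ)
    {ε : ℝ} (hε : 0 < ε) {Pis : ℝ} (hPis : 0 ≤ Pis) {v : S → A → E}
    (hv : ∀ s, ∑ a, v s a = 0) (hvn : ∀ s a, ‖v s a‖ ≤ Pis * π s a) {T t : ℕ} (ht : t < T) :
    ‖policyGradientTerm γ r p μ π v T t - clippedTerm γ r p μ ε π π' v T t‖ ≤
      Pis * Rs * (2 * γ / (1 - γ) ^ 2 + 2 / (1 - γ) * (1 + 1 / ε)) * δ := by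
  have h1γ : 0 < 1 - γ := sub_pos.2 hγ1
  have hπn : ∀ s a, 0 ≤ π s a := fun s a => (hπ0 s a).le
  have hπn' : ∀ s a, 0 ≤ π' s a := fun s a => (hπ0' s a).le
  have hd' : ∑ s, |stateMarginal p μ π' t s| = 1 := by
    simp only [abs_of_nonneg (stateMarginal_nonneg hp0 hμ0 hπn' t _)]
    exact sum_stateMarginal hp1 hμ1 hπ1' t
  rw [policyGradientTerm_sub_clippedTerm ε π π' hv, norm_smul, Real.norm_eq_abs,
    abs_of_nonneg (pow_nonneg hγ0.le t)]
  have hX1 := norm_sum_smul_score_le hvn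
    (fun s => stateMarginal p μ π t s - stateMarginal p μ π' t s)
    (fun s a => qAux γ r p π (T - (t + 1)) s a)
    (fun s => sum_abs_mul_le (hπn s) (hπ1 s) fun a =>
      (abs_qAux_le hγ0 hγ1 hr hp0 hp1 hπn hπ1 (T - (t + 1)) s a).trans
        (mul_le_mul_of_nonneg_left (geom_div_le_inv hγ0 hγ1 _) hRs)) hPis
  have hX1' := hX1.trans (mul_le_mul_of_nonneg_right
    (sum_abs_stateMarginal_sub_le hp0 hp1 hμ0 hμ1 hπn hπ1 hπn' hπ1' hδ t)
    (show 0 ≤ Pis * (Rs * (1 / (1 - γ))) by positivity))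
  have hX2 := norm_sum_smul_score_le hvn (fun s => stateMarginal p μ π' t s)
    (fun s a => qAux γ r p π (T - (t + 1)) s a - qAux γ r p π' (T - (t + 1)) s a)
    (fun s => sum_abs_mul_le (hπn s) (hπ1 s) fun a =>
      abs_qAux_sub_le_of_abs_valAux_sub_le hγ0 hp0 hp1
        (abs_valAux_sub_le hγ0 hγ1 hRs hr hp0 hp1 hπn hπ1 hπn' hπ1' hδ0 hδ _) s a) hPis
  have hclip : ∀ s, ∑ a, |Adv γ r p π' T t s a *
      (1 - if |π s a / π' s a - 1| ≤ ε then (1 : ℝ) else 0)| * π s a ≤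
      2 * Rs * (1 / (1 - γ)) * ((1 + 1 / ε) * δ) := by
    intro s
    refine le_trans ?_ (mul_le_mul_of_nonneg_left
      ((sum_mul_not_clip_le hε (u := π s) (hπ0' s)).trans
        (mul_le_mul_of_nonneg_left (hδ s) (by positivity))) (by positivity))
    rw [Finset.mul_sum]
    refine Finset.sum_le_sum fun a _ => ?_
    have hA := (abs_Adv_le hγ0 hγ1 hRs hr hp0 hp1 hπn' hπ1' ht s a).trans
      (mul_le_mul_of_nonneg_left (geom_div_le_inv hγ0 hγ1 T) (by positivity))
    have hind : 0 ≤ 1 - if |π s a / π' s a - 1| ≤ ε then (1 : ℝ) else 0 := by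
      split_ifs <;> norm_num
    rw [abs_mul, abs_of_nonneg hind, mul_assoc, mul_comm (π s a)]
    exact mul_le_mul_of_nonneg_right hA (mul_nonneg hind (hπn s a))
  have hX3 := norm_sum_smul_score_le hvn (fun s => stateMarginal p μ π' t s) _ hclip hPis
  rw [hd', one_mul] at hX2 hX3
  refine (mul_le_mul_of_nonneg_left (norm_add₃_le.trans
    (add_le_add (add_le_add hX1' hX2) hX3)) (pow_nonneg hγ0.le t)).trans ?_
  have hg1 : γ ^ t ≤ 1 := pow_le_one₀ hγ0.le hγ1.le
  have hgt : (t : ℝ) * γ ^ t ≤ γ / (1 - γ) := by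
    rw [le_div_iff₀ h1γ]; exact mul_pow_mul_one_sub_le hγ0 hγ1 t
  rw [mul_add, mul_add]
  have e1 : γ ^ t * (t * δ * (Pis * (Rs * (1 / (1 - γ))))) ≤
      γ / (1 - γ) * (δ * (Pis * (Rs * (1 / (1 - γ))))) := by
    calc _ = (t : ℝ) * γ ^ t * (δ * (Pis * (Rs * (1 / (1 - γ))))) := by ring
      _ ≤ _ := mul_le_mul_of_nonneg_right hgt (by positivity)
  refine (add_le_add (add_le_add e1 (mul_le_of_le_one_left (by positivity) hg1))
    (mul_le_of_le_one_left (by positivity) hg1)).trans (le_of_eq ?_)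
  field_simp
  ring

theorem norm_clippedTerm_le (hγ0 : 0 < γ) (hγ1 : γ < 1) (hRs : 0 ≤ Rs)
    (hr : ∀ s a, |r s a| ≤ Rs)
    (hp0 : ∀ s a s', 0 ≤ p s a s') (hp1 : ∀ s a, ∑ s', p s a s' = 1)
    (hμ0 : ∀ s, 0 ≤ μ s) (hμ1 : ∑ s, μ s = 1) {π π' : S → A → ℝ}
    (hπ0 : ∀ s a, 0 ≤ π s a) (hπ1 : ∀ s, ∑ a, π s a = 1)
    (hπ0' : ∀ s a, 0 ≤ π' s a) (hπ1' : ∀ s, ∑ a, π' s a = 1)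
    (ε : ℝ) {Pis : ℝ} (hPis : 0 ≤ Pis) {v : S → A → E}
    (hvn : ∀ s a, ‖v s a‖ ≤ Pis * π s a) {T t : ℕ} (ht : t < T) :
    ‖clippedTerm γ r p μ ε π π' v T t‖ ≤
      γ ^ t * (Pis * (2 * Rs * ((1 - γ ^ T) / (1 - γ)))) := by
  have hx : ∀ s a, |(if |π s a / π' s a - 1| ≤ ε then (1 : ℝ) else 0) * Adv γ r p π' T t s a| ≤
      2 * Rs * ((1 - γ ^ T) / (1 - γ)) := by
    intro s a
    refine le_trans ?_ (abs_Adv_le hγ0 hγ1 hRs hr hp0 hp1 hπ0' hπ1' ht s a)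
    split_ifs <;> simp
  have h := norm_sum_smul_score_le hvn (fun s => γ ^ t * stateMarginal p μ π' t s) _
    (fun s => sum_abs_mul_le (hπ0 s) (hπ1 s) (hx s)) hPis
  have hd' : ∑ s, |γ ^ t * stateMarginal p μ π' t s| = γ ^ t := by
    simp only [abs_of_nonneg (mul_nonneg (pow_nonneg hγ0.le t)
      (stateMarginal_nonneg hp0 hμ0 hπ0' t _))]
    rw [← Finset.mul_sum, sum_stateMarginal hp1 hμ1 hπ1', mul_one]
  rw [hd'] at h
  simpa only [clippedTerm, mul_assoc] using h

end Bias

section CyclicAscent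

theorem sum_range_sq_cast (K : ℕ) :
    ∑ e ∈ Finset.range K, (e : ℝ) ^ 2 = K * ((K : ℝ) - 1) * (2 * K - 1) / 6 := by
  induction K with
  | zero => simp
  | succ K ih =>
    rw [Finset.sum_range_succ, ih]
    push_cast
    ring

variable {E : Type*} [NormedAddCommGroup E] [InnerProductSpace ℝ E]

theorem norm_sub_start_le {g : E → E} {G η : ℝ} (hη0 : 0 < η) (hG : ∀ x, ‖g x‖ ≤ G) {K : ℕ}
    {x : ℕ → E} (hstep : ∀ e < K, x (e + 1) = x e + η • g (x e)) (e : ℕ) (he : e ≤ K) :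
    ‖x e - x 0‖ ≤ e * (η * G) := by
  induction e with
  | zero => simp
  | succ e ih =>
    rw [hstep e he, add_sub_right_comm]
    refine (norm_add_le _ _).trans ?_
    rw [norm_smul, Real.norm_eq_abs, abs_of_pos hη0]
    have := mul_le_mul_of_nonneg_left (hG (x e)) hη0.le
    have := ih (by omega)
    push_cast
    linarith

variable [CompleteSpace E]

/-- Best-iterate bound for cyclic gradient ascent along a surrogate gradient `g x y` whose error
grows linearly in the distance of `x` to the point `y` frozen at the start of each cycle. -/
theorem cyclic_ascent_best_iterate {J : E → ℝ} (hJ : Differentiable ℝ J)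
    (hbdd : BddAbove (Set.range J)) {L : ℝ} (hL : 0 < L)
    (hLip : ∀ x y, ‖gradient J x - gradient J y‖ ≤ L * ‖x - y‖) {η : ℝ} (hη0 : 0 < η)
    (hη : η ≤ 1 / L) {g : E → E → E} {R G : ℝ} (hR : 0 ≤ R)
    (hbias : ∀ x y, ‖gradient J x - g x y‖ ≤ R * ‖x - y‖) (hG : ∀ x y, ‖g x y‖ ≤ G)
    {C K : ℕ} (hC : 1 ≤ C) (hK : 1 ≤ K) {Θ : ℕ → ℕ → E}
    (hstep : ∀ c e, e < K → Θ c (e + 1) = Θ c e + η • g (Θ c e) (Θ c 0))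
    (hcycle : ∀ c, Θ (c + 1) 0 = Θ c K) :
    ∃ c < C, ∃ e < K, ‖gradient J (Θ c e)‖ ^ 2 ≤
      2 * ((⨆ θ, J θ) - J (Θ 0 0)) / (η * C * K) +
        (1 / 6) * η ^ 2 * ((K : ℝ) - 1) * (2 * K - 1) * R ^ 2 * G ^ 2 := by
  have hone : ∀ c, ∀ e ∈ Finset.range K, η / 2 * ‖gradient J (Θ c e)‖ ^ 2 ≤
      (J (Θ c (e + 1)) - J (Θ c e)) + η / 2 * (R * (η * G)) ^ 2 * (e : ℝ) ^ 2 := by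
    intro c e he
    rw [Finset.mem_range] at he
    have h1 := inexact_ascent_step hJ hL hLip hη0 hη (Θ c e) (g (Θ c e) (Θ c 0))
    rw [← hstep c e he] at h1
    have h2 : ‖gradient J (Θ c e) - g (Θ c e) (Θ c 0)‖ ≤ R * (e * (η * G)) :=
      (hbias _ _).trans (mul_le_mul_of_nonneg_left (norm_sub_start_le (g := fun x => g x (Θ c 0))
        hη0 (fun x => hG x _) (hstep c) e he.le) hR)
    have h3 := mul_le_mul_of_nonneg_left (pow_le_pow_left₀ (norm_nonneg _) h2 2) (half_pos hη0).le
    linarith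
  have hsum : ∑ c ∈ Finset.range C, ∑ e ∈ Finset.range K, η / 2 * ‖gradient J (Θ c e)‖ ^ 2 ≤
      (J (Θ C 0) - J (Θ 0 0)) +
        C * (η / 2 * (R * (η * G)) ^ 2 * (K * ((K : ℝ) - 1) * (2 * K - 1) / 6)) := by
    calc _ ≤ ∑ c ∈ Finset.range C, ((J (Θ (c + 1) 0) - J (Θ c 0)) +
          η / 2 * (R * (η * G)) ^ 2 * (K * ((K : ℝ) - 1) * (2 * K - 1) / 6)) := by
          refine Finset.sum_le_sum fun c _ => (Finset.sum_le_sum (hone c)).trans (le_of_eq ?_)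
          rw [Finset.sum_add_distrib, ← Finset.mul_sum, sum_range_sq_cast,
            Finset.sum_range_sub (fun e => J (Θ c e)), hcycle]
      _ = _ := by
          rw [Finset.sum_add_distrib, Finset.sum_range_sub (fun c => J (Θ c 0)),
            Finset.sum_const, Finset.card_range, nsmul_eq_mul]
  have hCpos : (0 : ℝ) < C := by exact_mod_cast hC
  have hKpos : (0 : ℝ) < K := by exact_mod_cast hK
  by_contra! hcon
  set B := 2 * ((⨆ θ, J θ) - J (Θ 0 0)) / (η * C * K) +
        (1 / 6) * η ^ 2 * ((K : ℝ) - 1) * (2 * K - 1) * R ^ 2 * G ^ 2 with hB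
  have hlt : ∑ c ∈ Finset.range C, ∑ e ∈ Finset.range K, η / 2 * B <
      ∑ c ∈ Finset.range C, ∑ e ∈ Finset.range K, η / 2 * ‖gradient J (Θ c e)‖ ^ 2 := by
    refine Finset.sum_lt_sum_of_nonempty (Finset.nonempty_range_iff.2 (by omega)) fun c hc =>
      Finset.sum_lt_sum_of_nonempty (Finset.nonempty_range_iff.2 (by omega)) fun e he =>
        mul_lt_mul_of_pos_left (hcon c (Finset.mem_range.1 hc) e (Finset.mem_range.1 he))
          (half_pos hη0)
  simp only [Finset.sum_const, Finset.card_range, nsmul_eq_mul] at hlt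
  have heq : (C : ℝ) * (K * (η / 2 * B)) = ((⨆ θ, J θ) - J (Θ 0 0)) +
      C * (η / 2 * (R * (η * G)) ^ 2 * (K * ((K : ℝ) - 1) * (2 * K - 1) / 6)) := by
    rw [hB]
    field_simp
  have hsup : J (Θ C 0) ≤ ⨆ θ, J θ := le_ciSup hbdd _
  linarith

end CyclicAscent

/-- **deterministic PPO convergence, Theorem 2.** For cyclic surrogate
gradient ascent with `C` cycles of length `K`, step size `0 < η ≤ 1/L`, and `∇J`
`L`-Lipschitz, the minimal squared gradient norm along the iterates is at most
`2Δ₀/(ηCK) + (1/6) η² (K-1)(2K-1) R² G²`, where `Δ₀ = sup J - J(θ_{0,0})`,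
`R = Π_*² R_* (8Tγ/(1-γ)³ + (2T/(1-γ))(1+1/ε))` and
`G = 2 Π_* R_* ((1-γ^T)/(1-γ))²`. -/
theorem deterministic_ppo_convergence {S A : Type*} [Fintype S] [Fintype A]
    [Nonempty S] [Nonempty A] {d : ℕ}
    (γ : ℝ) (hγ0 : 0 < γ) (hγ1 : γ < 1)
    (T : ℕ) (hT : 1 ≤ T)
    (Rs : ℝ) (r : S → A → ℝ) (hr : ∀ s a, |r s a| ≤ Rs)
    (p : S → A → S → ℝ) (hp0 : ∀ s a s', 0 ≤ p s a s') (hp1 : ∀ s a, ∑ s', p s a s' = 1)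
    (μ : S → ℝ) (hμ0 : ∀ s, 0 ≤ μ s) (hμ1 : ∑ s, μ s = 1)
    (π : EuclideanSpace ℝ (Fin d) → S → A → ℝ)
    (hπpos : ∀ θ s a, 0 < π θ s a)
    (hπ1 : ∀ θ s, ∑ a, π θ s a = 1)
    (hπdiff : ∀ s a, ContDiff ℝ 1 fun θ => π θ s a)
    (Pis : ℝ)
    (hscore : ∀ θ s a, ‖gradient (fun θ' => π θ' s a) θ‖ ≤ Pis * π θ s a)
    (ε : ℝ) (hε : 0 < ε)
    (J : EuclideanSpace ℝ (Fin d) → ℝ)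
    (hJ : J = fun θ => ∑ s, μ s * Vval γ r p (π θ) T 0 s)
    (hJdiff : Differentiable ℝ J)
    (L : ℝ) (hL : 0 < L)
    (hLip : ∀ θ θ' : EuclideanSpace ℝ (Fin d),
      ‖gradient J θ - gradient J θ'‖ ≤ L * ‖θ - θ'‖)
    (C K : ℕ) (hC : 1 ≤ C) (hK : 1 ≤ K)
    (η : ℝ) (hη0 : 0 < η) (hη : η ≤ 1 / L)
    (Θ : ℕ → ℕ → EuclideanSpace ℝ (Fin d))
    (hstep : ∀ c e, e < K →
      Θ c (e + 1) = Θ c e + η • gPPOclip γ r p μ T ε π (Θ c e) (Θ c 0))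
    (hcycle : ∀ c, Θ (c + 1) 0 = Θ c K) :
    ∃ c < C, ∃ e < K,
      ‖gradient J (Θ c e)‖ ^ 2
        ≤ 2 * ((⨆ θ, J θ) - J (Θ 0 0)) / (η * (C : ℝ) * (K : ℝ))
          + (1 / 6) * η ^ 2 * ((K : ℝ) - 1) * (2 * (K : ℝ) - 1)
            * (Pis ^ 2 * Rs * (8 * (T : ℝ) * γ / (1 - γ) ^ 3
                + (2 * (T : ℝ) / (1 - γ)) * (1 + 1 / ε))) ^ 2
            * (2 * Pis * Rs * ((1 - γ ^ T) / (1 - γ)) ^ 2) ^ 2 := by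
  obtain ⟨s₀⟩ := ‹Nonempty S›
  obtain ⟨a₀⟩ := ‹Nonempty A›
  have hRs : 0 ≤ Rs := (abs_nonneg _).trans (hr s₀ a₀)
  have hPis : 0 ≤ Pis :=
    nonneg_of_mul_nonneg_left ((norm_nonneg _).trans (hscore 0 s₀ a₀)) (hπpos 0 s₀ a₀)
  have h1γ : 0 < 1 - γ := sub_pos.2 hγ1
  have hπ0 : ∀ θ s a, 0 ≤ π θ s a := fun θ s a => (hπpos θ s a).le
  have hdiff : ∀ s a, Differentiable ℝ fun θ => π θ s a := fun s a =>
    (hπdiff s a).differentiable one_ne_zero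
  have hgrad : ∀ θ s a, HasGradientAt (fun θ' => π θ' s a)
      (gradient (fun θ' => π θ' s a) θ) θ := fun θ s a => (hdiff s a θ).hasGradientAt
  have hzero : ∀ θ s, ∑ a, gradient (fun θ' => π θ' s a) θ = 0 := fun θ s => by
    have h := HasGradientAt.fun_sum_real Finset.univ fun a _ => hgrad θ s a
    simp only [hπ1] at h
    exact h.unique (hasGradientAt_const θ 1)
  have hclip : ∀ θ θold, gPPOclip γ r p μ T ε π θ θold = ∑ t ∈ Finset.range T,
      clippedTerm γ r p μ ε (π θ) (π θold) (fun s a => gradient (fun θ' => π θ' s a) θ) T t :=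
    fun _ _ => rfl
  refine cyclic_ascent_best_iterate (g := gPPOclip γ r p μ T ε π) hJdiff ?_ hL hLip hη0 hη
    (by positivity) (fun θ θold => ?_) (fun θ θold => ?_) hC hK hstep hcycle
  · refine ⟨Rs * ((1 - γ ^ T) / (1 - γ)), ?_⟩
    rintro _ ⟨θ, rfl⟩
    rw [hJ]
    exact (le_abs_self _).trans (abs_weighted_sum_le _ _ _ hμ0 hμ1
      (abs_valAux_le hγ0 hγ1 hr hp0 hp1 (hπ0 θ) (hπ1 θ) T))
  · rw [hJ, (hasGradientAt_objective (hgrad θ) μ T).gradient, hclip, ← Finset.sum_sub_distrib]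
    refine (norm_sum_le _ _).trans ((Finset.sum_le_sum fun t ht =>
      norm_policyGradientTerm_sub_clippedTerm_le hγ0 hγ1 hRs hr hp0 hp1 hμ0 hμ1 (hπpos θ) (hπ1 θ)
        (hπpos θold) (hπ1 θold) (mul_nonneg hPis (norm_nonneg (θ - θold)))
        (fun s => sum_abs_policy_sub_le (fun θ => hπ1 θ s) (hdiff s)
          (fun θ a => hscore θ s a) θ θold)
        hε hPis (hzero θ) (hscore θ) (Finset.mem_range.1 ht)).trans ?_)
    rw [Finset.sum_const, Finset.card_range, nsmul_eq_mul]
    have hγ : 2 * γ / (1 - γ) ^ 2 ≤ 8 * γ / (1 - γ) ^ 3 := by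
      rw [div_le_div_iff₀ (by positivity) (by positivity)]
      have : γ * (1 - γ) ^ 2 * (2 * (1 - γ)) ≤ γ * (1 - γ) ^ 2 * 8 :=
        mul_le_mul_of_nonneg_left (by linarith) (by positivity)
      linarith
    calc _ = Pis ^ 2 * Rs * T * ‖θ - θold‖ *
          (2 * γ / (1 - γ) ^ 2 + 2 / (1 - γ) * (1 + 1 / ε)) := by ring
      _ ≤ Pis ^ 2 * Rs * T * ‖θ - θold‖ *
          (8 * γ / (1 - γ) ^ 3 + 2 / (1 - γ) * (1 + 1 / ε)) :=
        mul_le_mul_of_nonneg_left (by linarith) (by positivity)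
      _ = _ := by ring
  · rw [hclip]
    refine (norm_sum_le _ _).trans ((Finset.sum_le_sum fun t ht =>
      norm_clippedTerm_le hγ0 hγ1 hRs hr hp0 hp1 hμ0 hμ1 (hπ0 θ) (hπ1 θ) (hπ0 θold) (hπ1 θold)
        ε hPis (hscore θ) (Finset.mem_range.1 ht)).trans (le_of_eq ?_))
    rw [← Finset.sum_mul, geom_sum_eq hγ1.ne, ← neg_div_neg_eq, neg_sub, neg_sub]
    ring
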